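/- Let k₋ < k₊ be real numbers and suppose γ satisfies (k₋ + A)(1 − (1−λ)^Δ) ≤ γ ≤ (k₊ − A)(1 − (1−λ)^Δ). Then F maps the interval [k₋, k₊] into itself: for every x ∈ [k₋, k₊] one has k₋ ≤ F(x) ≤ k₊. -/

import Mathlib

/-- If `f` stays within `A * (1 - q)` of multiplication by `q`, then its `n`-th iterate stays within
`A * (1 - q ^ n)` of multiplication by `q ^ n`. -/
lemma abs_iterate_sub_pow_mul_le {f : ℝ → ℝ} {q A : ℝ} (hq : 0 ≤ q)
    (hf : ∀ y, |f y - q * y| ≤ A * (1 - q)) (n : ℕ) (x : ℝ) :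
    |f^[n] x - q ^ n * x| ≤ A * (1 - q ^ n) := by
  induction n with
  | zero => simp
  | succ n ih =>
    rw [Function.iterate_succ_apply']
    calc |f (f^[n] x) - q ^ (n + 1) * x|
        = |(f (f^[n] x) - q * f^[n] x) + q * (f^[n] x - q ^ n * x)| := by ring_nf
      _ ≤ |f (f^[n] x) - q * f^[n] x| + q * |f^[n] x - q ^ n * x| := by
        refine (abs_add_le _ _).trans_eq ?_
        rw [abs_mul, abs_of_nonneg hq]
      _ ≤ A * (1 - q) + q * (A * (1 - q ^ n)) := by gcongr; exact hf _
      _ = A * (1 - q ^ (n + 1)) := by ring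

lemma abs_arctan_le_pi_div_two (x : ℝ) : |Real.arctan x| ≤ Real.pi / 2 :=
  abs_le.2 ⟨by linarith [Real.neg_pi_div_two_lt_arctan x], (Real.arctan_lt_pi_div_two x).le⟩

/-- if `(k₋+A)(1−(1−λ)^Δ) ≤ γ ≤ (k₊−A)(1−(1−λ)^Δ)` then `F` maps
`[k₋, k₊]` into itself (here `km = k₋`, `kp = k₊`). -/
theorem composed_map_maps_interval_into_itself
    (a b μ lam γ A : ℝ) (hb : 0 < b) (hμ : 0 < μ) (hlam : 0 < lam) (hlam1 : lam < 1)
    (f : ℝ → ℝ)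
    (hf : ∀ y : ℝ, f y = (1 - lam) * y + (a / b) * lam - (lam / b) * Real.arctan (μ * y))
    (hA : A = |a| / b + Real.pi / (2 * b))
    (Δ : ℕ) (hΔ : 1 ≤ Δ)
    (F : ℝ → ℝ) (hF : ∀ y : ℝ, F y = f^[Δ] y + γ)
    (km kp : ℝ) (hk : km < kp)
    (hγ₁ : (km + A) * (1 - (1 - lam) ^ Δ) ≤ γ)
    (hγ₂ : γ ≤ (kp - A) * (1 - (1 - lam) ^ Δ)) :
    ∀ x ∈ Set.Icc km kp, F x ∈ Set.Icc km kp := by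
  intro x hx
  have hstep (y : ℝ) : |f y - (1 - lam) * y| ≤ A * (1 - (1 - lam)) := by
    have hsplit : f y - (1 - lam) * y = lam / b * (a - Real.arctan (μ * y)) := by
      rw [hf]; ring
    rw [hsplit, abs_mul, abs_of_pos (div_pos hlam hb)]
    calc lam / b * |a - Real.arctan (μ * y)|
        ≤ lam / b * (|a| + Real.pi / 2) := by
          gcongr
          exact (abs_sub _ _).trans (by gcongr; exact abs_arctan_le_pi_div_two _)
      _ = A * (1 - (1 - lam)) := by rw [hA]; field_simp; ring
  have hq : 0 ≤ 1 - lam := by linarith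
  obtain ⟨hlower, hupper⟩ := abs_le.1 (abs_iterate_sub_pow_mul_le hq hstep Δ x)
  have hmin := mul_le_mul_of_nonneg_left hx.1 (pow_nonneg hq Δ)
  have hmax := mul_le_mul_of_nonneg_left hx.2 (pow_nonneg hq Δ)
  rw [hF]
  constructor <;> linarith
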